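/- Let f_{0,∞} and g_{0,∞} be equi-continuous sequences of continuous self-maps on compact metric spaces X and Y respectively. Suppose there exists a continuous surjective map π : X → Y with π ∘ f_n = g_n ∘ π for all n ≥ 0, and there exists c > 0 such that the fibre π^{-1}(y) has at most c points for every y ∈ Y. Then h(f_{0,∞}) = h(g_{0,∞}). -/

import Mathlib

open Filter Topology

/-- `comps f n` is `f_0^n = f_{n-1} ∘ ⋯ ∘ f_0`. -/
def comps {X : Type*} (f : ℕ → X → X) : ℕ → X → X
  | 0 => id
  | n + 1 => f n ∘ comps f n

/-- `E` is an `(n, ε)`-separated set for the non-autonomous system `f`. -/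
def IsSeparated {X : Type*} [MetricSpace X] (f : ℕ → X → X) (n : ℕ) (ε : ℝ) (E : Set X) : Prop :=
  ∀ x ∈ E, ∀ y ∈ E, x ≠ y → ∃ k < n, ε < dist (comps f k x) (comps f k y)

/-- The maximal cardinality of an `(n, ε)`-separated set. -/
noncomputable def sepNum {X : Type*} [MetricSpace X] (f : ℕ → X → X) (n : ℕ) (ε : ℝ) : ℕ :=
  sSup {m | ∃ E : Finset X, IsSeparated f n ε ↑E ∧ E.card = m}

/-- The topological entropy of the non-autonomous system `(X, f_{0,∞})`. -/
noncomputable def sepEntropy {X : Type*} [MetricSpace X] (f : ℕ → X → X) : EReal :=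
  ⨆ ε : {e : ℝ // 0 < e},
    Filter.limsup (fun n : ℕ => ((Real.log (sepNum f n ε) / n : ℝ) : EReal)) Filter.atTop

/-- The sequence `f` is equi-continuous. -/
def EquiCont {X : Type*} [MetricSpace X] (f : ℕ → X → X) : Prop :=
  ∀ ε > (0 : ℝ), ∃ δ > (0 : ℝ), ∀ x y : X, dist x y < δ → ∀ n : ℕ, dist (f n x) (f n y) < ε

theorem comps_cont {X : Type*} [MetricSpace X] (f : ℕ → X → X) (hf : ∀ n, Continuous (f n)) (n : ℕ) :
    Continuous (comps f n) := by
  induction n with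
  | zero => exact continuous_id
  | succ n ih => exact (hf n).comp ih

theorem comps_add {X : Type*} (f : ℕ → X → X) (i k : ℕ) (x : X) :
    comps f (i + k) x = comps (fun j => f (i + j)) k (comps f i x) := by
  induction k with
  | zero => rfl
  | succ k ih =>
    change f (i + k) (comps f (i + k) x) = f (i + k) _
    rw [ih]

theorem comps_semi {X Y : Type*} (f : ℕ → X → X) (g : ℕ → Y → Y) (π : X → Y)
    (hsemi : ∀ n, π ∘ f n = g n ∘ π) (n : ℕ) (x : X) :
    π (comps f n x) = comps g n (π x) := by
  induction n with
  | zero => rfl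
  | succ n ih =>
    change π (f n (comps f n x)) = g n (comps g n (π x))
    rw [← ih]
    exact congrFun (hsemi n) _

theorem card_le_label {X ι : Type*} [MetricSpace X] [Fintype ι] (f : ℕ → X → X) (n : ℕ) (ε : ℝ)
    (l : X → ι) (hl : ∀ x y, l x = l y → ∀ k < n, dist (comps f k x) (comps f k y) ≤ ε)
    (E : Finset X) (hE : IsSeparated f n ε ↑E) : E.card ≤ Fintype.card ι := by
  refine Finset.card_le_card_of_injOn (t := Finset.univ) l (by simp) ?_
  intro x hx y hy hxy
  by_contra hne
  obtain ⟨k, hk, h⟩ := hE x hx y hy hne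
  exact absurd (hl x y hxy k hk) (not_le.2 h)

theorem sepNum_le_label {X ι : Type*} [MetricSpace X] [Fintype ι] (f : ℕ → X → X) (n : ℕ) (ε : ℝ)
    (l : X → ι) (hl : ∀ x y, l x = l y → ∀ k < n, dist (comps f k x) (comps f k y) ≤ ε) :
    sepNum f n ε ≤ Fintype.card ι := by
  refine csSup_le ⟨0, ∅, by simp [IsSeparated], by simp⟩ ?_
  rintro m ⟨E, hE, rfl⟩
  exact card_le_label f n ε l hl E hE

theorem sep_bdd {X : Type*} [MetricSpace X] [CompactSpace X] (f : ℕ → X → X)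
    (hf : ∀ n, Continuous (f n)) (n : ℕ) (ε : ℝ) (hε : 0 < ε) :
    BddAbove {m | ∃ E : Finset X, IsSeparated f n ε ↑E ∧ E.card = m} := by
  have hφ : Continuous (fun x : X => fun k : Fin n => comps f k x) :=
    continuous_pi fun k => comps_cont f hf k
  have hu := CompactSpace.uniformContinuous_of_continuous hφ
  obtain ⟨δ, hδ, h⟩ := Metric.uniformContinuous_iff.1 hu ε hε
  obtain ⟨t, -, ht, hcov⟩ := Metric.totallyBounded_iff.1
    (isCompact_univ (X := X)).totallyBounded (δ / 2) (by positivity) |>.imp fun t ht =>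
      (⟨trivial, ht⟩ : True ∧ _)
  have : ∀ x : X, ∃ z : t, dist x z < δ / 2 := by
    intro x
    have := hcov (Set.mem_univ x)
    simp only [Set.mem_iUnion, Metric.mem_ball] at this
    obtain ⟨z, hz, hh⟩ := this
    exact ⟨⟨z, hz⟩, hh⟩
  choose l hl using this
  have := ht.fintype
  refine ⟨Fintype.card t, ?_⟩
  rintro m ⟨E, hE, rfl⟩
  refine card_le_label f n ε l ?_ E hE
  intro x y hxy k hk
  have h1 := hl x
  have h2 := hl y
  rw [← hxy] at h2
  have h3 : dist x y < δ := by
    have := dist_triangle_right x y (l x : X)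
    linarith
  exact (dist_le_pi_dist (fun k : Fin n => comps f k x) (fun k : Fin n => comps f k y) ⟨k, hk⟩).trans
    (h h3).le

theorem exists_max {X : Type*} [MetricSpace X] [CompactSpace X] (f : ℕ → X → X)
    (hf : ∀ n, Continuous (f n)) (n : ℕ) (ε : ℝ) (hε : 0 < ε) :
    ∃ E : Finset X, IsSeparated f n ε ↑E ∧ E.card = sepNum f n ε :=
  Nat.sSup_mem (s := {m | ∃ E : Finset X, IsSeparated f n ε ↑E ∧ E.card = m})
    ⟨0, ∅, by simp [IsSeparated], by simp⟩ (sep_bdd f hf n ε hε)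

theorem exists_span {X : Type*} [MetricSpace X] [CompactSpace X] (f : ℕ → X → X)
    (hf : ∀ n, Continuous (f n)) (n : ℕ) (ε : ℝ) (hε : 0 < ε) :
    ∃ E : Finset X, E.card = sepNum f n ε ∧
      ∀ x, ∃ e : E, ∀ k < n, dist (comps f k x) (comps f k e) ≤ ε := by
  classical
  obtain ⟨E, hE, hc⟩ := exists_max f hf n ε hε
  refine ⟨E, hc, fun x => ?_⟩
  by_contra! hx
  by_cases hxE : x ∈ E
  · obtain ⟨k, hk, h⟩ := hx ⟨x, hxE⟩
    rw [dist_self] at h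
    linarith
  have hsep : IsSeparated f n ε ↑(insert x E) := by
    intro a ha b hb hab
    simp only [Finset.coe_insert, Set.mem_insert_iff, Finset.mem_coe] at ha hb
    rcases ha with rfl | ha <;> rcases hb with rfl | hb
    · exact absurd rfl hab
    · exact hx ⟨b, hb⟩
    · obtain ⟨k, hk, h⟩ := hx ⟨a, ha⟩
      exact ⟨k, hk, by rwa [dist_comm]⟩
    · exact hE a ha b hb hab
  have := le_csSup (sep_bdd f hf n ε hε) ⟨insert x E, hsep, rfl⟩
  rw [Finset.card_insert_of_notMem hxE] at this
  change _ ≤ sepNum f n ε at this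
  omega

theorem equi_block {X : Type*} [MetricSpace X] (f : ℕ → X → X) (hef : EquiCont f) (N : ℕ) :
    ∀ ε > (0 : ℝ), ∃ η > (0 : ℝ), ∀ x y : X, dist x y < η → ∀ i, ∀ k < N,
      dist (comps (fun j => f (i + j)) k x) (comps (fun j => f (i + j)) k y) < ε := by
  have key : ∀ k : ℕ, ∀ ε > (0 : ℝ), ∃ η > (0 : ℝ), ∀ x y : X, dist x y < η → ∀ i,
      dist (comps (fun j => f (i + j)) k x) (comps (fun j => f (i + j)) k y) < ε := by
    intro k
    induction k with
    | zero => exact fun ε hε => ⟨ε, hε, fun x y h i => h⟩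
    | succ k ih =>
      intro ε hε
      obtain ⟨δ, hδ, h⟩ := hef ε hε
      obtain ⟨η, hη, h'⟩ := ih δ hδ
      exact ⟨η, hη, fun x y hxy i => h _ _ (h' x y hxy i) (i + k)⟩
  intro ε hε
  induction N with
  | zero => exact ⟨1, one_pos, fun x y _ i k hk => absurd hk (Nat.not_lt_zero _)⟩
  | succ N ih =>
    obtain ⟨η, hη, h⟩ := ih
    obtain ⟨η', hη', h'⟩ := key N ε hε
    refine ⟨min η η', lt_min hη hη', fun x y hxy i k hk => ?_⟩
    rcases Nat.lt_succ_iff_lt_or_eq.1 hk with hk | rfl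
    · exact h x y (hxy.trans_le (min_le_left _ _)) i k hk
    · exact h' x y (hxy.trans_le (min_le_right _ _)) i

theorem fibre_label {X Y : Type*}
    [MetricSpace X] [CompactSpace X] [MetricSpace Y] [CompactSpace Y]
    (π : X → Y) (hπc : Continuous π) (c : ℕ) (hc : 0 < c)
    (hfib : ∀ y : Y, (π ⁻¹' {y}).Finite ∧ (π ⁻¹' {y}).ncard ≤ c) (η : ℝ) (hη : 0 < η) :
    ∃ δ > (0 : ℝ), ∀ y : Y, ∃ L : X → Fin c, ∀ x x', dist (π x) y ≤ δ → dist (π x') y ≤ δ →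
      L x = L x' → dist x x' < η := by
  classical
  have h1 : ∀ y : Y, ∃ V : Set Y, IsOpen V ∧ y ∈ V ∧ ∃ L : X → Fin c, ∀ x x', π x ∈ V → π x' ∈ V →
      L x = L x' → dist x x' < η := by
    intro y
    obtain ⟨hfin, hcard⟩ := hfib y
    let U : Set X := ⋃ z ∈ π ⁻¹' {y}, Metric.ball z (η / 2)
    have hU : IsOpen U := isOpen_biUnion fun z _ => Metric.isOpen_ball
    have hK : IsClosed (π '' Uᶜ) := hπc.isClosedMap _ hU.isClosed_compl
    have hlab : ∀ x, ∃ z : X, x ∈ U → π z = y ∧ dist x z < η / 2 := by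
      intro x
      by_cases hx : x ∈ U
      · have hx' := hx
        simp only [U, Set.mem_iUnion, Metric.mem_ball] at hx'
        obtain ⟨z, hz, h⟩ := hx'
        exact ⟨z, fun _ => ⟨hz, h⟩⟩
      · exact ⟨x, fun h => absurd h hx⟩
    choose l hl using hlab
    have : Fintype (π ⁻¹' {y}) := hfin.fintype
    have hcard' : Fintype.card (π ⁻¹' {y}) ≤ Fintype.card (Fin c) := by
      rw [Fintype.card_fin, ← Nat.card_eq_fintype_card]; exact hcard
    obtain ⟨e⟩ := Function.Embedding.nonempty_of_card_le hcard'
    refine ⟨(π '' Uᶜ)ᶜ, hK.isOpen_compl, ?_,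
      fun x => if h : π (l x) = y then e ⟨l x, h⟩ else ⟨0, hc⟩, ?_⟩
    · rintro ⟨z, hz, hzy⟩
      exact hz (Set.mem_biUnion (show z ∈ π ⁻¹' {y} from hzy) (Metric.mem_ball_self (half_pos hη)))
    · intro x x' hx hx' hL
      have hxU : x ∈ U := by
        by_contra h
        exact hx ⟨x, h, rfl⟩
      have hxU' : x' ∈ U := by
        by_contra h
        exact hx' ⟨x', h, rfl⟩
      obtain ⟨a, b⟩ := hl x hxU
      obtain ⟨a', b'⟩ := hl x' hxU'
      simp only [a, a', dif_pos] at hL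
      have h := congrArg Subtype.val (e.injective hL)
      simp only at h
      rw [← h] at b'
      have := dist_triangle_right x x' (l x)
      linarith
  choose V hVo hyV hL using h1
  obtain ⟨δ, hδ, h⟩ := lebesgue_number_lemma_of_metric (isCompact_univ (X := Y)) hVo
    (fun y _ => Set.mem_iUnion.2 ⟨y, hyV y⟩)
  refine ⟨δ / 2, half_pos hδ, fun y => ?_⟩
  obtain ⟨i, hi⟩ := h y (Set.mem_univ y)
  obtain ⟨L, hL⟩ := hL i
  refine ⟨L, fun x x' hx hx' => hL x x' (hi ?_) (hi ?_)⟩ <;>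
  · rw [Metric.mem_ball]; linarith

theorem main_count {X Y : Type*}
    [MetricSpace X] [CompactSpace X] [MetricSpace Y] [CompactSpace Y]
    (f : ℕ → X → X) (g : ℕ → Y → Y) (hg : ∀ n, Continuous (g n))
    (hef : EquiCont f) 
    (π : X → Y) (hπc : Continuous π) 
    (hsemi : ∀ n, π ∘ f n = g n ∘ π)
    (c : ℕ) (hc : 0 < c)
    (hfib : ∀ y : Y, (π ⁻¹' {y}).Finite ∧ (π ⁻¹' {y}).ncard ≤ c)
    (ε : ℝ) (hε : 0 < ε) (N : ℕ) (hN : 0 < N) :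
    ∃ δ > (0 : ℝ), ∀ n, sepNum f n ε ≤ sepNum g n δ * c ^ (n / N + 1) := by
  obtain ⟨η, hη, h⟩ := equi_block f hef N ε hε
  obtain ⟨δ, hδ, h'⟩ := fibre_label π hπc c hc hfib η hη
  choose L hL using h'
  refine ⟨δ, hδ, fun n => ?_⟩
  obtain ⟨E, hEc, hE⟩ := exists_span g hg n δ hδ
  choose e he using hE
  have := sepNum_le_label (ι := E × (Fin (n / N + 1) → Fin c)) f n ε
    (fun x => (e (π x), fun q => L (comps g (q * N) (e (π x))) (comps f (q * N) x))) ?_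
  · simpa [hEc] using this
  intro x x' hxx k hk
  obtain ⟨h1, h2⟩ := Prod.mk.inj hxx
  have hq : k / N < n / N + 1 := Nat.lt_succ_of_le (Nat.div_le_div_right hk.le)
  have h3 := congrFun h2 ⟨k / N, hq⟩
  simp only [← h1] at h3
  have hlt : k / N * N < n := (Nat.div_mul_le_self k N).trans_lt hk
  have h4 := hL _ (comps f (k / N * N) x) (comps f (k / N * N) x')
    (by rw [comps_semi f g π hsemi]; exact he (π x) _ hlt)
    (by rw [comps_semi f g π hsemi, h1]; exact he (π x') _ hlt) h3
  have h5 := h _ _ h4 (k / N * N) (k % N) (Nat.mod_lt _ hN)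
  rw [← comps_add, ← comps_add, Nat.div_add_mod'] at h5
  exact h5.le

theorem easy_count {X Y : Type*}
    [MetricSpace X] [CompactSpace X] [MetricSpace Y] [CompactSpace Y]
    (f : ℕ → X → X) (g : ℕ → Y → Y) (hf : ∀ n, Continuous (f n))
    (π : X → Y) (hπc : Continuous π) (hπs : Function.Surjective π)
    (hsemi : ∀ n, π ∘ f n = g n ∘ π)
    (ε : ℝ) (hε : 0 < ε) :
    ∃ δ > (0 : ℝ), ∀ n, sepNum g n ε ≤ sepNum f n δ := by
  classical
  obtain ⟨δ, hδ, h⟩ := Metric.uniformContinuous_iff.1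
    (CompactSpace.uniformContinuous_of_continuous hπc) ε hε
  refine ⟨δ / 2, half_pos hδ, fun n => ?_⟩
  choose s hs using hπs
  refine csSup_le ⟨0, ∅, by simp [IsSeparated], by simp⟩ ?_
  rintro m ⟨E, hE, rfl⟩
  have hinj : Function.Injective s := Function.LeftInverse.injective hs
  refine le_csSup (sep_bdd f hf n (δ / 2) (half_pos hδ)) ⟨E.image s, ?_, Finset.card_image_of_injective _ hinj⟩
  intro a ha b hb hab
  simp only [Finset.coe_image, Set.mem_image, Finset.mem_coe] at ha hb
  obtain ⟨a, ha, rfl⟩ := ha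
  obtain ⟨b, hb, rfl⟩ := hb
  obtain ⟨k, hk, hd⟩ := hE a ha b hb (fun h => hab (by rw [h]))
  refine ⟨k, hk, ?_⟩
  by_contra! hle
  have := h (a := comps f k (s a)) (b := comps f k (s b)) (by linarith)
  rw [comps_semi f g π hsemi, comps_semi f g π hsemi, hs, hs] at this
  linarith

theorem log_bound (a b c N n : ℕ) (hc : 0 < c) (hN : 0 < N) (hn : N ≤ n)
    (h : a ≤ b * c ^ (n / N + 1)) :
    Real.log a / n ≤ Real.log b / n + 2 * Real.log c / N := by
  have hlc : 0 ≤ Real.log c := Real.log_natCast_nonneg c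
  have hlb : 0 ≤ Real.log b := Real.log_natCast_nonneg b
  rcases Nat.eq_zero_or_pos a with rfl | ha
  · simp only [Nat.cast_zero, Real.log_zero, zero_div]; positivity
  have hb : 0 < b := by
    rcases Nat.eq_zero_or_pos b with rfl | hb
    · simp at h; omega
    · exact hb
  have hNr : (0 : ℝ) < N := by exact_mod_cast hN
  have hnN : (N : ℝ) ≤ n := by exact_mod_cast hn
  have hnr : (0 : ℝ) < n := hNr.trans_le hnN
  have h1 : Real.log a ≤ Real.log b + ((n / N : ℕ) + 1 : ℝ) * Real.log c := by
    have : Real.log a ≤ Real.log ((b : ℝ) * (c : ℝ) ^ (n / N + 1)) :=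
      Real.log_le_log (by exact_mod_cast ha) (by exact_mod_cast h)
    rw [Real.log_mul (by positivity) (by positivity), Real.log_pow] at this
    exact_mod_cast this
  have h2 : ((n / N : ℕ) + 1 : ℝ) ≤ 2 * n / N := by
    have h3 : ((n / N : ℕ) : ℝ) ≤ n / N := Nat.cast_div_le
    have h4 : (1 : ℝ) ≤ n / N := (one_le_div hNr).2 hnN
    have : 2 * (n : ℝ) / N = n / N + n / N := by ring
    linarith
  have h3 : Real.log a ≤ Real.log b + 2 * n / N * Real.log c :=
    h1.trans (by gcongr)
  calc Real.log a / n ≤ (Real.log b + 2 * n / N * Real.log c) / n := by gcongr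
    _ = _ := by field_simp

/-- If `(X, f_{0,∞})` is topologically `π`-equi-semiconjugate to `(Y, g_{0,∞})`
via a finite-to-one map `π` and both sequences are equi-continuous, then the
topological entropies coincide. -/
theorem sepEntropy_eq_of_finiteToOne_semiconj {X Y : Type*}
    [MetricSpace X] [CompactSpace X] [MetricSpace Y] [CompactSpace Y]
    (f : ℕ → X → X) (g : ℕ → Y → Y)
    (hf : ∀ n, Continuous (f n)) (hg : ∀ n, Continuous (g n))
    (hef : EquiCont f) (heg : EquiCont g)
    (π : X → Y) (hπc : Continuous π) (hπs : Function.Surjective π)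
    (hsemi : ∀ n, π ∘ f n = g n ∘ π)
    (c : ℕ) (hc : 0 < c)
    (hfib : ∀ y : Y, (π ⁻¹' {y}).Finite ∧ (π ⁻¹' {y}).ncard ≤ c) :
    sepEntropy f = sepEntropy g := by
  apply le_antisymm
  · refine iSup_le fun ε => ?_
    refine EReal.le_of_forall_lt_iff_le.1 ?_
    intro z hz
    by_contra! hcon
    obtain ⟨w, hw1, hw2⟩ := EReal.lt_iff_exists_real_btwn.1 hz
    have hwz : w < z := by exact_mod_cast hw2
    obtain ⟨N, hN⟩ := exists_nat_gt (max 0 (2 * Real.log c / (z - w)))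
    have hN0 : (0 : ℝ) < N := (le_max_left _ _).trans_lt hN
    have hN1 : 2 * Real.log c / N ≤ z - w := by
      have := ((le_max_right _ _).trans_lt hN).le
      rw [div_le_iff₀ (by linarith)] at this
      rw [div_le_iff₀ hN0]; linarith
    have hNn : 0 < N := by exact_mod_cast hN0
    obtain ⟨δ, hδ, h⟩ := main_count f g hg hef π hπc hsemi c hc hfib ε.1 ε.2 N hNn
    have hlim : Filter.limsup (fun n : ℕ => ((Real.log (sepNum g n δ) / n : ℝ) : EReal))
        Filter.atTop < w :=
      (le_iSup (fun ε : {e : ℝ // 0 < e} => Filter.limsup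
        (fun n : ℕ => ((Real.log (sepNum g n ε) / n : ℝ) : EReal)) Filter.atTop) ⟨δ, hδ⟩).trans_lt hw1
    have hev := Filter.eventually_lt_of_limsup_lt hlim
    refine absurd hcon (not_lt.2 (Filter.limsup_le_of_le (by isBoundedDefault) ?_))
    filter_upwards [hev, Filter.eventually_ge_atTop N] with n hn1 hn2
    have h1 := log_bound _ _ c N n hc hNn hn2 (h n)
    have h2 : Real.log (sepNum g n δ) / n < w := by exact_mod_cast hn1
    exact_mod_cast (by linarith : Real.log (sepNum f n ε) / n ≤ z)
  · refine iSup_le fun ε => ?_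
    obtain ⟨δ, hδ, h⟩ := easy_count f g hf π hπc hπs hsemi ε.1 ε.2
    refine le_trans ?_ (le_iSup (fun ε : {e : ℝ // 0 < e} => Filter.limsup
        (fun n : ℕ => ((Real.log (sepNum f n ε) / n : ℝ) : EReal)) Filter.atTop) ⟨δ, hδ⟩)
    refine Filter.limsup_le_limsup (Filter.Eventually.of_forall fun n => ?_)
      (by isBoundedDefault) (by isBoundedDefault)
    have h0 : Real.log (sepNum g n ε) ≤ Real.log (sepNum f n δ) := by
      rcases Nat.eq_zero_or_pos (sepNum g n ε) with h0 | h0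
      · rw [h0]; simpa using Real.log_natCast_nonneg _
      · exact Real.log_le_log (by exact_mod_cast h0) (by exact_mod_cast h n)
    exact EReal.coe_le_coe_iff.2 (by gcongr)
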